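/- arXiv:1812.05791 — 3 statements merged into one kernel-verified Lean document; each statement's English description precedes it below -/
import Mathlib

section
/- If $Q$ is a primary ideal of a commutative ring $R$, then for any $n \in \mathbb{N}$, $Q$ is $n$-absorbing if and only if $(\sqrt{Q})^n \subseteq Q$. -/
open Ideal Finset MvPolynomial

/-- `I` is an `N`-absorbing ideal: whenever a product of `N+1` elements lies in `I`,
the product of some `N` of them (omitting one factor) lies in `I`. -/
def IsNAbsorbing {R : Type*} [CommRing R] (I : Ideal R) (N : ℕ) : Prop :=
  ∀ x : Fin (N + 1) → R, (∏ i, x i) ∈ I →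
    ∃ j, (∏ i ∈ Finset.univ.erase j, x i) ∈ I

/-- `ω(I)`: the least `N` such that `I` is `N`-absorbing. -/
noncomputable def omegaAbs {R : Type*} [CommRing R] (I : Ideal R) : ℕ :=
  sInf {N | IsNAbsorbing I N}

open scoped Classical in
/-- The absorbing property in terms of multisets, for every length exceeding `n`. -/
theorem IsNAbsorbing.exists_erase_prod_mem {R : Type*} [CommRing R] {I : Ideal R} {n : ℕ}
    (hI : IsNAbsorbing I n) {d : ℕ} (hd : n ≤ d) (S : Multiset R) (hS : S.card = d + 1)
    (hprod : S.prod ∈ I) : ∃ a ∈ S, (S.erase a).prod ∈ I := by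
  induction d, hd using Nat.le_induction generalizing S with
  | base =>
    induction S using Quotient.inductionOn with
    | h l =>
      have hl : l.length = n + 1 := hS
      obtain ⟨x, rfl⟩ : ∃ x : Fin (n + 1) → R, l = List.ofFn x := by
        rw [← hl]
        exact ⟨l.get, (List.ofFn_get l).symm⟩
      have hval : (Finset.univ : Finset (Fin (n + 1))).val.map x = (List.ofFn x : Multiset R) :=
        Fin.univ_val_map x
      change (List.ofFn x : Multiset R).prod ∈ I at hprod
      change ∃ a ∈ (List.ofFn x : Multiset R), ((List.ofFn x : Multiset R).erase a).prod ∈ I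
      rw [← hval] at hprod ⊢
      obtain ⟨j, hj⟩ := hI x hprod
      refine ⟨x j, Multiset.mem_map_of_mem x (Finset.mem_univ j), ?_⟩
      rw [← Multiset.map_erase_of_mem x _ (Finset.mem_univ j)]
      convert hj using 1
      rw [Finset.prod, Finset.erase_val]
  | succ d _ ih =>
    obtain ⟨a, S, rfl⟩ := Multiset.card_pos_iff_exists_mem.1 (by omega : 0 < S.card) |>.imp
      fun a ha => Multiset.exists_cons_of_mem ha
    rw [Multiset.card_cons] at hS
    obtain ⟨b, T, rfl⟩ := Multiset.card_pos_iff_exists_mem.1 (by omega : 0 < S.card) |>.imp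
      fun a ha => Multiset.exists_cons_of_mem ha
    rw [Multiset.card_cons] at hS
    obtain ⟨c, hc, hcI⟩ := ih ((a * b) ::ₘ T) (by rw [Multiset.card_cons]; omega)
      (by simpa [mul_assoc] using hprod)
    by_cases hcT : c ∈ T
    · refine ⟨c, by simp [hcT], ?_⟩
      rw [Multiset.erase_cons_tail_of_mem hcT] at hcI
      rw [Multiset.erase_cons_tail_of_mem (Multiset.mem_cons_of_mem hcT),
        Multiset.erase_cons_tail_of_mem hcT]
      simpa [mul_assoc] using hcI
    · obtain rfl : c = a * b := by simpa [hcT] using hc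
      refine ⟨a, by simp, ?_⟩
      rw [Multiset.erase_cons_head] at hcI ⊢
      rw [Multiset.prod_cons]
      exact I.mul_mem_left _ hcI

/-- Avoidance of finitely many ideals by a combination of elements that are in triangular
position with respect to them. -/
theorem Ideal.exists_mem_span_forall_notMem {R ι : Type*} [CommRing R] [LinearOrder ι]
    (S : Finset ι) (N : ι → Ideal R) (x : ι → R) (hdiag : ∀ i ∈ S, x i ∉ N i)
    (hlt : ∀ i ∈ S, ∀ j ∈ S, j < i → x j ∈ N i) :
    ∃ y ∈ Ideal.span (Set.range x), ∀ i ∈ S, y ∉ N i := by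
  induction S using Finset.induction_on_min with
  | empty => exact ⟨0, zero_mem _, by simp⟩
  | insert a S ha ih =>
    obtain ⟨y, hy, hyN⟩ := ih (fun i hi => hdiag i (Finset.mem_insert_of_mem hi))
      fun i hi j hj => hlt i (Finset.mem_insert_of_mem hi) j (Finset.mem_insert_of_mem hj)
    by_cases hya : y ∈ N a
    · refine ⟨y + x a, add_mem hy (Ideal.subset_span ⟨a, rfl⟩), fun i hi => ?_⟩
      rcases Finset.mem_insert.1 hi with rfl | hiS
      · rw [(N i).add_mem_iff_right hya]
        exact hdiag i hi
      · rw [(N i).add_mem_iff_left (hlt i hi a (Finset.mem_insert_self a S) (ha i hiS))]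
        exact hyN i hiS
    · refine ⟨y, hy, fun i hi => ?_⟩
      rcases Finset.mem_insert.1 hi with rfl | hiS
      exacts [hya, hyN i hiS]

/-- For an `n`-absorbing ideal, if all monomials of degree `d + 1 > n` in given elements lie in
the ideal, then so do those of degree `d`. -/
theorem IsNAbsorbing.prod_map_mem_of_succ {R : Type*} [CommRing R] {I : Ideal R} {n d k : ℕ}
    (hI : IsNAbsorbing I n) (hd : n ≤ d) (x : Fin k → R)
    (hsucc : ∀ s : Multiset (Fin k), s.card = d + 1 → (s.map x).prod ∈ I)
    (s : Multiset (Fin k)) (hs : s.card = d) : (s.map x).prod ∈ I := by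
  classical
  induction hp : (s.map Fin.val).sum using Nat.strong_induction_on generalizing s with
  | h p ih =>
    by_contra hsI
    let N : Fin k → Ideal R := fun i => Submodule.comap (LinearMap.mulLeft R ((s.erase i).map x).prod) I
    have hN (i : Fin k) (r : R) : r ∈ N i ↔ r * ((s.erase i).map x).prod ∈ I := by
      rw [mul_comm]; rfl
    obtain ⟨y, hy, hyN⟩ := Ideal.exists_mem_span_forall_notMem s.toFinset N x
      (fun i hi => by
        rwa [hN, ← Multiset.prod_cons, ← Multiset.map_cons,
          Multiset.cons_erase (Multiset.mem_toFinset.1 hi)])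
      (fun i hi j _ hji => by
        rw [hN, ← Multiset.prod_cons, ← Multiset.map_cons]
        have hi := Multiset.mem_toFinset.1 hi
        refine ih _ ?_ (j ::ₘ s.erase i) ?_ rfl
        · rw [← hp]
          conv_rhs => rw [← Multiset.cons_erase hi]
          simpa using hji
        · rw [Multiset.card_cons, Multiset.card_erase_add_one hi, hs])
    have hyI : y * (s.map x).prod ∈ I := by
      clear hyN
      induction hy using Submodule.span_induction with
      | mem z hz =>
        obtain ⟨i, rfl⟩ := hz
        rw [← Multiset.prod_cons, ← Multiset.map_cons]
        exact hsucc _ (by rw [Multiset.card_cons, hs])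
      | zero => simp
      | add a b _ _ ha hb => rw [add_mul]; exact add_mem ha hb
      | smul a b _ hb => rw [smul_eq_mul, mul_assoc]; exact I.mul_mem_left _ hb
    obtain ⟨a, ha, haI⟩ := hI.exists_erase_prod_mem hd (y ::ₘ s.map x) (by simp [hs])
      (by rwa [Multiset.prod_cons])
    by_cases has : a ∈ s.map x
    · obtain ⟨i, hi, rfl⟩ := Multiset.mem_map.1 has
      refine hyN i (Multiset.mem_toFinset.2 hi) ((hN i y).2 ?_)
      rwa [Multiset.erase_cons_tail_of_mem has, ← Multiset.map_erase_of_mem x _ hi,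
        Multiset.prod_cons] at haI
    · obtain rfl : a = y := (Multiset.mem_cons.1 ha).resolve_right has
      rw [Multiset.erase_cons_head] at haI
      exact hsI haI

theorem IsNAbsorbing.radical_pow_le {R : Type*} [CommRing R] {I : Ideal R} {n : ℕ}
    (hI : IsNAbsorbing I n) : I.radical ^ n ≤ I := by
  suffices h : ∀ x : Fin n → R, (∀ i, x i ∈ I.radical) → ∏ i, x i ∈ I by
    rw [← Ideal.span_eq I.radical, Ideal.span, Submodule.span_pow, Submodule.span_le]
    intro a ha
    obtain ⟨f, rfl⟩ := Set.mem_pow.1 ha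
    rw [List.prod_ofFn]
    exact h _ fun i => (f i).2
  intro x hx
  classical
  obtain ⟨m, hm⟩ := Ideal.exists_pow_le_of_le_radical_of_fg
    (Ideal.span_le.2 (Set.range_subset_iff.2 hx) : Ideal.span (Set.range x) ≤ I.radical)
    ⟨Finset.univ.image x, by simp [Ideal.span]⟩
  have hpow (s : Multiset (Fin n)) : (s.map x).prod ∈ Ideal.span (Set.range x) ^ s.card := by
    induction s using Multiset.induction_on with
    | empty => simp
    | cons i s ih =>
      rw [Multiset.map_cons, Multiset.prod_cons, Multiset.card_cons, pow_succ']
      exact Ideal.mul_mem_mul (Ideal.subset_span ⟨i, rfl⟩) ih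
  have hall : ∀ s : Multiset (Fin n), s.card = n → (s.map x).prod ∈ I := by
    refine Nat.decreasingInduction' (n := max m n)
      (P := fun d => ∀ s : Multiset (Fin n), s.card = d → (s.map x).prod ∈ I)
      (fun d _ hd hsucc => hI.prod_map_mem_of_succ hd x hsucc) (le_max_right m n) ?_
    intro s hs
    exact hm (Ideal.pow_le_pow_right (hs ▸ le_max_left m n) (hpow s))
  exact hall Finset.univ.val (by simp)

theorem Ideal.IsPrimary.isNAbsorbing_of_radical_pow_le {R : Type*} [CommRing R] {Q : Ideal R}
    (hQ : Q.IsPrimary) {n : ℕ} (h : Q.radical ^ n ≤ Q) : IsNAbsorbing Q n := by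
  intro x hx
  by_cases hall : ∀ i, x i ∈ Q.radical
  · refine ⟨0, h ?_⟩
    have hmem := Ideal.prod_mem_prod (s := Finset.univ.erase (0 : Fin (n + 1)))
      (I := fun _ => Q.radical) (x := x) fun i _ => hall i
    simpa using hmem
  · push Not at hall
    obtain ⟨j, hj⟩ := hall
    rw [← Finset.prod_erase_mul _ _ (Finset.mem_univ j)] at hx
    exact ⟨j, ((Ideal.isPrimary_iff.1 hQ).2 hx).resolve_right hj⟩

theorem primary_nAbsorbing_iff {R : Type*} [CommRing R] (Q : Ideal R) (hQ : Q.IsPrimary)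
    (n : ℕ) (hn : 1 ≤ n) :
    IsNAbsorbing Q n ↔ Q.radical ^ n ≤ Q :=
  ⟨fun h => h.radical_pow_le, hQ.isNAbsorbing_of_radical_pow_le⟩
end

section
/- For any ideal $I$ of a commutative ring $R$ and any $n \in \mathbb{N}$, if $I$ is $n$-absorbing then $(\sqrt{I})^n \subseteq I$ (i.e., the Noether exponent of $I$ is at most $n$). -/
open Ideal Finset MvPolynomial

/-- If `J ^ n` is tested on products of elements of `J`, it is contained in `I`. -/
theorem Ideal.pow_le_of_forall_prod_mem {R : Type*} [CommRing R] {I J : Ideal R} {n : ℕ}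
    (h : ∀ x : Fin n → R, (∀ i, x i ∈ J) → ∏ i, x i ∈ I) : J ^ n ≤ I := by
  rw [Submodule.pow_eq_span_pow_set]
  refine Submodule.span_le.2 fun a ha => ?_
  obtain ⟨f, rfl⟩ := Set.mem_pow.1 ha
  rw [List.prod_ofFn]
  exact h _ fun i => (f i).2

namespace IsNAbsorbing

variable {R : Type*} [CommRing R] {I : Ideal R} {n : ℕ}

/-- For an `n`-absorbing ideal, a multiplier `l` of `∏ y i` into `I` must also multiply
one of the products with a factor omitted into `I`, unless `∏ y i` is in `I` itself. -/
theorem prod_mem_or_exists_mul_prod_erase_mem (h : IsNAbsorbing I n) (y : Fin n → R) (l : R)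
    (hl : l * ∏ i, y i ∈ I) :
    ∏ i, y i ∈ I ∨ ∃ i, l * ∏ k ∈ univ.erase i, y k ∈ I := by
  obtain ⟨j, hj⟩ := h (Fin.cons l y) (by simpa [Fin.prod_univ_succ] using hl)
  induction j using Fin.cases with
  | zero =>
    left
    have : (univ : Finset (Fin (n + 1))).erase 0 = univ.map (Fin.succEmb n) := by
      ext k
      induction k using Fin.cases <;> simp
    simpa [this] using hj
  | succ i =>
    right
    refine ⟨i, ?_⟩
    have : (univ : Finset (Fin (n + 1))).erase i.succ =
        insert 0 ((univ.erase i).map (Fin.succEmb n)) := by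
      ext k
      induction k using Fin.cases <;> simp [(Fin.succ_ne_zero _).symm]
    rw [this, prod_insert (by simp), prod_map] at hj
    exact hj

/-- Let `ν` be a multiplicative family indexed by a linearly ordered cancellative monoid, with
only finitely many members outside the `n`-absorbing ideal `I`. Then every product of `n` members
with positive index is in `I`. -/
theorem map_sum_mem {Γ : Type*} [AddCommMonoid Γ] [LinearOrder Γ] [IsOrderedCancelAddMonoid Γ]
    (h : IsNAbsorbing I n) (ν : Multiplicative Γ →* R)
    (hfin : {f : Γ | ν (.ofAdd f) ∉ I}.Finite) (g : Fin n → Γ) (hg : ∀ i, 0 < g i) :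
    ν (.ofAdd (∑ i, g i)) ∈ I := by
  by_contra hgI
  let S : Set Γ := {f | ν (.ofAdd f) ∉ I ∧ ∃ g : Fin n → Γ, (∀ i, 0 < g i) ∧ ∑ i, g i = f}
  obtain ⟨f, ⟨hfI, g, hg, rfl⟩, hmax⟩ :=
    (hfin.subset fun f hf => hf.1 : S.Finite).exists_maximal ⟨_, hgI, g, hg, rfl⟩
  have key : ∀ i w, g i < w → ν (.ofAdd (∑ k ∈ univ.erase i, g k + w)) ∈ I := by
    intro i w hw
    by_contra hc
    have hsum : ∑ k, Function.update g i w k = ∑ k ∈ univ.erase i, g k + w := by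
      rw [sum_update_of_mem (mem_univ i), sdiff_singleton_eq_erase, add_comm]
    refine (hmax (y := ∑ k ∈ univ.erase i, g k + w)
      ⟨hc, Function.update g i w, ?_, hsum⟩ ?_).not_gt ?_
    · intro k
      obtain rfl | hk := eq_or_ne k i
      · simpa using (hg k).trans hw
      · simpa [hk] using hg k
    all_goals rw [← sum_erase_add _ _ (mem_univ i)]; gcongr
  have hν : ∀ a b : Γ, ν (.ofAdd (a + b)) = ν (.ofAdd a) * ν (.ofAdd b) := fun a b => by
    rw [ofAdd_add, map_mul]
  have hprod : ∀ s : Finset (Fin n), ν (.ofAdd (∑ i ∈ s, g i)) = ∏ i ∈ s, ν (.ofAdd (g i)) :=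
    fun s => by rw [ofAdd_sum, map_prod]
  have greedy : ∀ s : Finset Γ, s ⊆ univ.image g →
      ∃ l : R, l * ν (.ofAdd (∑ i, g i)) ∈ I ∧
        ∀ i, g i ∈ s → l * ν (.ofAdd (∑ k ∈ univ.erase i, g k)) ∉ I := by
    intro s
    induction s using Finset.induction_on_max with
    | empty => exact fun _ => ⟨0, by simp, by simp⟩
    | insert v s hv ih =>
      intro hs
      obtain ⟨l, hl, hls⟩ := ih ((subset_insert _ _).trans hs)
      by_cases hlv : ∀ i, g i = v → l * ν (.ofAdd (∑ k ∈ univ.erase i, g k)) ∉ I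
      · refine ⟨l, hl, fun i hi => ?_⟩
        exact (mem_insert.1 hi).elim (hlv i) (hls i)
      push Not at hlv
      obtain ⟨i₀, rfl, hi₀⟩ := hlv
      refine ⟨l + ν (.ofAdd (g i₀)), ?_, fun i hi hmem => ?_⟩
      · rw [add_mul]
        refine I.add_mem hl ?_
        rw [mul_comm, ← hν, ← sum_erase_add _ _ (mem_univ i₀), add_assoc]
        exact key _ _ (lt_add_of_pos_right _ (hg i₀))
      · rw [add_mul, mul_comm (ν (.ofAdd (g i₀))), ← hν] at hmem
        obtain hi | hi := mem_insert.1 hi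
        · have hrest : ∑ k ∈ univ.erase i, g k = ∑ k ∈ univ.erase i₀, g k := by
            apply add_right_cancel (b := g i₀)
            rw [sum_erase_add _ _ (mem_univ i₀), ← hi, sum_erase_add _ _ (mem_univ i)]
          rw [hrest, sum_erase_add _ _ (mem_univ i₀)] at hmem
          exact hfI ((I.add_mem_iff_right hi₀).1 hmem)
        · exact hls i hi ((I.add_mem_iff_left (key _ _ (hv _ hi))).1 hmem)
  obtain ⟨l, hl, hls⟩ := greedy _ subset_rfl
  rw [hprod] at hl hfI
  obtain hy | ⟨i, hi⟩ := h.prod_mem_or_exists_mul_prod_erase_mem _ l hl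
  · exact hfI hy
  · exact hls i (mem_image_of_mem g (mem_univ i)) (by rwa [hprod])

end IsNAbsorbing

/-- The monomial with exponent `f` in the family `x`, as a multiplicative function of the exponent
with its lexicographic order. -/
def lexMonomial {R ι : Type*} [CommRing R] [Fintype ι] (x : ι → R) :
    Multiplicative (Lex (ι → ℕ)) →* R where
  toFun f := ∏ i, x i ^ ofLex f.toAdd i
  map_one' := prod_eq_one fun i _ => pow_zero (x i)
  map_mul' _ _ := (prod_congr rfl fun i _ => pow_add (x i) _ _).trans prod_mul_distrib

/-- If all `x i` lie in the radical of `I`, only finitely many monomials in `x` are outside `I`. -/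
theorem finite_lexMonomial_notMem {R ι : Type*} [CommRing R] [Fintype ι] {I : Ideal R}
    {x : ι → R} (hx : ∀ i, x i ∈ I.radical) :
    {f : Lex (ι → ℕ) | lexMonomial x (.ofAdd f) ∉ I}.Finite := by
  choose N hN using hx
  refine Set.Finite.subset ((Set.Finite.pi' fun i => Set.finite_Iio (N i)).image toLex) ?_
  refine fun f hf => ⟨ofLex f, fun i => ?_, rfl⟩
  by_contra hi
  refine hf (I.mem_of_dvd (dvd_prod_of_mem _ (mem_univ i)) ?_)
  exact I.mem_of_dvd (pow_dvd_pow _ (not_lt.1 hi)) (hN i)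

theorem noetherExponent_le_of_nAbsorbing {R : Type*} [CommRing R] (I : Ideal R)
    (n : ℕ) (hn : 1 ≤ n) (h : IsNAbsorbing I n) :
    I.radical ^ n ≤ I := by
  refine Ideal.pow_le_of_forall_prod_mem fun x hx => ?_
  have hpos : ∀ i : Fin n, (0 : Lex (Fin n → ℕ)) < toLex (Pi.single i 1) := fun i =>
    Pi.toLex_strictMono (a := 0) (by simp)
  have hmem := h.map_sum_mem (lexMonomial x) (finite_lexMonomial_notMem hx) _ hpos
  rw [ofAdd_sum, map_prod] at hmem
  simpa [lexMonomial, Pi.single_apply, pow_ite] using hmem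
end

section
/- Let $R = k[x_1,\ldots,x_n]$ over a field $k$ and let $I = (x_{i_1}^{a_1}, \ldots, x_{i_r}^{a_r})$ be an irreducible monomial ideal with $a_s = \max_j a_j$. Then $\omega(I^m) = m\,\omega(I)$ for all $m \in \mathbb{N}$ if and only if $a_j = 1$ for all $j \ne s$. -/
open Ideal Finset MvPolynomial

/-- Absorption for `Fin`-indexed products passes to products over a finset of larger size. -/
lemma IsNAbsorbing.exists_prod_erase_mem {R : Type*} [CommRing R] {I : Ideal R} {N : ℕ}
    (h : IsNAbsorbing I N) {ι : Type*} [DecidableEq ι] (t : Finset ι) (x : ι → R)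
    (hN : N < #t) (hx : ∏ j ∈ t, x j ∈ I) : ∃ j ∈ t, ∏ l ∈ t.erase j, x l ∈ I := by
  obtain ⟨d, hd⟩ := Nat.exists_eq_add_of_lt hN
  induction d generalizing t x with
  | zero =>
    let e : t ≃ Fin (N + 1) := t.equivFinOfCardEq (by omega)
    have hprod : ∏ l, x (e.symm l) ∈ I := by
      rw [Equiv.prod_comp e.symm (fun u : t => x u), Finset.prod_coe_sort]
      exact hx
    obtain ⟨j, hj⟩ := h _ hprod
    refine ⟨e.symm j, (e.symm j).2, ?_⟩
    convert hj using 1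
    symm
    refine Finset.prod_bij (fun l _ => (e.symm l : ι)) ?_ ?_ ?_ ?_
    · intro l hl
      simpa [Subtype.coe_inj] using hl
    · intro l _ l' _ hll
      simpa [Subtype.coe_inj] using hll
    · intro b hb
      rw [Finset.mem_erase] at hb
      refine ⟨e ⟨b, hb.2⟩, ?_, by simp⟩
      simp only [Finset.mem_erase, Finset.mem_univ, and_true]
      intro hbj
      exact hb.1 (by simp [← hbj])
    · intros; rfl
  | succ d ih =>
    obtain ⟨b, hb, c, hc, hbc⟩ := Finset.one_lt_card.mp (by omega : 1 < #t)
    have hct : c ∈ t.erase b := Finset.mem_erase.mpr ⟨hbc.symm, hc⟩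
    have hcard : #(t.erase b) = #t - 1 := Finset.card_erase_of_mem hb
    have merge : ∀ u : Finset ι, b ∈ u → c ∈ u →
        ∏ l ∈ u.erase b, Function.update x c (x b * x c) l = ∏ l ∈ u, x l := by
      intro u hbu hcu
      have hcu' : c ∈ u.erase b := Finset.mem_erase.mpr ⟨hbc.symm, hcu⟩
      rw [Finset.prod_update_of_mem hcu', ← Finset.mul_prod_erase u x hbu,
        ← Finset.mul_prod_erase _ x hcu', Finset.sdiff_singleton_eq_erase, mul_assoc]
    obtain ⟨j, hj, hjI⟩ := ih (t.erase b) (Function.update x c (x b * x c)) (by omega)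
      (by rwa [merge t hb hc]) (by omega)
    rw [Finset.mem_erase] at hj
    by_cases hjc : j = c
    · subst hjc
      refine ⟨j, hj.2, ?_⟩
      rw [Finset.prod_update_of_notMem (Finset.notMem_erase _ _), Finset.erase_right_comm] at hjI
      rw [← Finset.mul_prod_erase _ x (Finset.mem_erase.mpr ⟨hbc, hb⟩)]
      exact I.mul_mem_left _ hjI
    · refine ⟨j, hj.2, ?_⟩
      rwa [Finset.erase_right_comm, merge _ (Finset.mem_erase.mpr ⟨Ne.symm hj.1, hb⟩)
        (Finset.mem_erase.mpr ⟨Ne.symm hjc, hc⟩)] at hjI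

lemma IsNAbsorbing.comap {R S : Type*} [CommRing R] [CommRing S] (f : R →+* S) {J : Ideal S}
    {N : ℕ} (h : IsNAbsorbing J N) : IsNAbsorbing (J.comap f) N := by
  intro x hx
  obtain ⟨j, hj⟩ := h (fun l => f (x l)) (by simpa [Ideal.mem_comap, map_prod] using hx)
  exact ⟨j, by simpa [Ideal.mem_comap, map_prod] using hj⟩

/-- An ideal containing `P ^ N`, modulo which every element outside `P` is regular,
is `N`-absorbing. -/
lemma isNAbsorbing_of_pow_le {R : Type*} [CommRing R] {P Q : Ideal R} {N : ℕ} (hPQ : P ^ N ≤ Q)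
    (hQ : ∀ f g, f ∉ P → f * g ∈ Q → g ∈ Q) : IsNAbsorbing Q N := by
  intro x hx
  by_cases hP : ∀ j, x j ∈ P
  · refine ⟨0, hPQ ?_⟩
    have := Ideal.prod_mem_prod (s := Finset.univ.erase (0 : Fin (N + 1)))
      (I := fun _ => P) (x := x) (fun j _ => hP j)
    simpa using this
  · push Not at hP
    obtain ⟨j, hj⟩ := hP
    refine ⟨j, hQ _ _ hj ?_⟩
    rwa [Finset.mul_prod_erase _ _ (Finset.mem_univ j)]

section VariablePowers

variable {A : Type*} [CommRing A] {r : ℕ}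

lemma le_sum_div_of_mem_pow (a : Fin r → ℕ) (ha : ∀ j, 1 ≤ a j) (m : ℕ)
    {f : MvPolynomial (Fin r) A}
    (hf : f ∈ Ideal.span (Set.range fun j => (X j : MvPolynomial (Fin r) A) ^ a j) ^ m)
    {β : Fin r →₀ ℕ} (hβ : coeff β f ≠ 0) : m ≤ ∑ j, β j / a j := by
  induction m generalizing f β with
  | zero => exact Nat.zero_le _
  | succ m ih =>
    rw [pow_succ] at hf
    induction hf using Submodule.mul_induction_on' generalizing β with
    | mem_mul_mem p hp q hq =>
      obtain ⟨u, hu, hne⟩ := Finset.exists_ne_zero_of_sum_ne_zero (coeff_mul p q β ▸ hβ)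
      have hp0 : coeff u.1 p ≠ 0 := left_ne_zero_of_mul hne
      have hq0 : coeff u.2 q ≠ 0 := right_ne_zero_of_mul hne
      have h1 := ih hp hp0
      have h2 : ∃ j, a j ≤ u.2 j := by
        have hq' : q ∈ Ideal.span ((fun s => monomial s (1 : A)) ''
            (Set.range fun j => Finsupp.single j (a j))) := by
          rw [← Set.range_comp]
          simpa [Function.comp_def, X_pow_eq_monomial] using hq
        rw [mem_ideal_span_monomial_image] at hq'
        obtain ⟨_, ⟨j, rfl⟩, hj⟩ := hq' u.2 (mem_support_iff.mpr hq0)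
        exact ⟨j, by simpa using hj j⟩
      obtain ⟨j, hj⟩ := h2
      have h3 : 1 ≤ ∑ j, u.2 j / a j :=
        (Nat.div_pos hj (ha j)).trans_le
          (Finset.single_le_sum (f := fun j => u.2 j / a j) (fun _ _ => Nat.zero_le _)
            (Finset.mem_univ j))
      have h4 : ∑ j, u.1 j / a j + ∑ j, u.2 j / a j ≤ ∑ j, β j / a j := by
        rw [← Finset.sum_add_distrib, ← Finset.HasAntidiagonal.mem_antidiagonal.mp hu]
        exact Finset.sum_le_sum fun j _ => Nat.div_add_div_le_add_div
      omega
    | add p _ q _ hp hq =>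
      rw [coeff_add] at hβ
      by_cases h0 : coeff β p = 0
      · exact hq (by simpa [h0] using hβ)
      · exact hp h0

lemma monomial_mem_pow (a : Fin r → ℕ) (m : ℕ) (β : Fin r →₀ ℕ) (c : A)
    (h : m ≤ ∑ j, β j / a j) : monomial β c ∈
      Ideal.span (Set.range fun j => (X j : MvPolynomial (Fin r) A) ^ a j) ^ m := by
  have hprod : ∏ j, ((X j : MvPolynomial (Fin r) A) ^ a j) ^ (β j / a j) ∈
      Ideal.span (Set.range fun j => (X j : MvPolynomial (Fin r) A) ^ a j) ^ m := by
    refine Ideal.pow_le_pow_right h ?_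
    rw [← Finset.prod_pow_eq_pow_sum]
    exact Ideal.prod_mem_prod fun j _ =>
      Ideal.pow_mem_pow (Ideal.subset_span (Set.mem_range_self j)) _
  refine Ideal.mem_of_dvd _ ?_ hprod
  rw [monomial_eq, Finsupp.prod_fintype _ _ (by simp)]
  refine Dvd.dvd.mul_left (Finset.prod_dvd_prod_of_dvd _ _ fun j _ => ?_) _
  rw [← pow_mul]
  exact pow_dvd_pow _ (Nat.mul_div_le _ _)

lemma mem_span_X_pow_pow_iff (a : Fin r → ℕ) (ha : ∀ j, 1 ≤ a j) (m : ℕ)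
    (f : MvPolynomial (Fin r) A) :
    f ∈ Ideal.span (Set.range fun j => (X j : MvPolynomial (Fin r) A) ^ a j) ^ m ↔
      ∀ β, coeff β f ≠ 0 → m ≤ ∑ j, β j / a j := by
  refine ⟨fun hf β hβ => le_sum_div_of_mem_pow a ha m hf hβ, fun h => ?_⟩
  rw [f.as_sum]
  exact Ideal.sum_mem _ fun β hβ => monomial_mem_pow a m β _ (h β (mem_support_iff.mp hβ))

/-- Elements with nonzero constant coefficient are regular modulo powers of an ideal generated
by powers of the variables. -/
lemma mem_of_mul_mem_of_coeff_zero_ne_zero [IsDomain A] (a : Fin r → ℕ) (ha : ∀ j, 1 ≤ a j)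
    (m : ℕ) {f g : MvPolynomial (Fin r) A} (hf : coeff 0 f ≠ 0)
    (hfg : f * g ∈ Ideal.span (Set.range fun j => (X j : MvPolynomial (Fin r) A) ^ a j) ^ m) :
    g ∈ Ideal.span (Set.range fun j => (X j : MvPolynomial (Fin r) A) ^ a j) ^ m := by
  rw [mem_span_X_pow_pow_iff a ha] at hfg ⊢
  by_contra! hg
  obtain ⟨β, ⟨hβ, hβm⟩, hmin⟩ := WellFounded.has_min (wellFounded_lt (α := Fin r →₀ ℕ))
    {β | coeff β g ≠ 0 ∧ ∑ j, β j / a j < m} hg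
  refine absurd (hfg β ?_) (not_le.mpr hβm)
  rw [coeff_mul, Finset.sum_eq_single (0, β)]
  · exact mul_ne_zero hf hβ
  · rintro ⟨u, v⟩ huv hne
    rw [Finset.HasAntidiagonal.mem_antidiagonal] at huv
    simp only at huv
    by_contra h0
    have hvβ : v ≤ β := huv ▸ le_add_self
    have hlt : v < β := by
      refine lt_of_le_of_ne hvβ ?_
      rintro rfl
      exact hne (by simpa using huv)
    refine hmin v ⟨right_ne_zero_of_mul h0, lt_of_le_of_lt ?_ hβm⟩ hlt
    exact Finset.sum_le_sum fun j _ => Nat.div_le_div_right (hvβ j)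
  · simp

lemma isNAbsorbing_span_X_pow_pow [IsDomain A] (a : Fin r → ℕ) (ha : ∀ j, 1 ≤ a j)
    (s : Fin r) (hs : ∀ j, a j ≤ a s) (m : ℕ) :
    IsNAbsorbing (Ideal.span (Set.range fun j => (X j : MvPolynomial (Fin r) A) ^ a j) ^ (m + 1))
      (m * a s + ∑ j, (a j - 1) + 1) := by
  have hone := mem_span_X_pow_pow_iff (A := A) (r := r) (fun _ => 1) (fun _ => le_rfl)
  refine isNAbsorbing_of_pow_le
    (P := Ideal.span (Set.range fun j => (X j : MvPolynomial (Fin r) A) ^ 1)) ?_ ?_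
  · intro f hf
    rw [hone] at hf
    rw [mem_span_X_pow_pow_iff a ha]
    intro β hβ
    have hdeg := hf β hβ
    simp only [Nat.div_one] at hdeg
    by_contra! hlt
    have hle : ∑ j, β j ≤ (∑ j, β j / a j) * a s + ∑ j, (a j - 1) := by
      rw [Finset.sum_mul, ← Finset.sum_add_distrib]
      refine Finset.sum_le_sum fun j _ => ?_
      have h1 := Nat.div_add_mod (β j) (a j)
      have h2 := Nat.mod_lt (β j) (ha j)
      have h3 : a j * (β j / a j) ≤ (β j / a j) * a s := by
        rw [mul_comm]; exact Nat.mul_le_mul_left _ (hs j)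
      omega
    have hmul : (∑ j, β j / a j) * a s ≤ m * a s := Nat.mul_le_mul_right _ (by omega)
    omega
  · intro f g hf hfg
    refine mem_of_mul_mem_of_coeff_zero_ne_zero a ha _ (fun h0 => hf ?_) hfg
    have := (hone 1 f).mpr fun β hβ => ?_
    · simpa using this
    · by_contra! hlt
      have hz : β = 0 := by
        ext j
        have := Finset.sum_eq_zero_iff.mp (Nat.lt_one_iff.mp hlt) j (Finset.mem_univ j)
        simpa using this
      exact hβ (hz ▸ h0)

end VariablePowers

/-- A polynomial ring over a field embeds in a polynomial ring in chosen variables, with domain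
coefficients, compatibly with all ideals generated by powers of these variables. -/
lemma exists_ringHom_comap_eq {k : Type*} [Field k] {n r : ℕ} (i : Fin r → Fin n)
    (hi : Function.Injective i) (a : Fin r → ℕ) (m : ℕ) :
    ∃ φ : MvPolynomial (Fin n) k →+* MvPolynomial (Fin r) (MvPolynomial (Fin n) k),
      (∀ j, φ (X (i j)) = X j) ∧
      Ideal.span (Set.range fun j => (X (i j) : MvPolynomial (Fin n) k) ^ a j) ^ m =
        (Ideal.span (Set.range fun j =>
          (X j : MvPolynomial (Fin r) (MvPolynomial (Fin n) k)) ^ a j) ^ m).comap φ := by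
  let φ : MvPolynomial (Fin n) k →+* MvPolynomial (Fin r) (MvPolynomial (Fin n) k) :=
    eval₂Hom (C.comp C) (Function.extend i X fun t => C (X t))
  let ψ : MvPolynomial (Fin r) (MvPolynomial (Fin n) k) →+* MvPolynomial (Fin n) k :=
    eval₂Hom (RingHom.id _) fun j => X (i j)
  have hφ : ∀ j, φ (X (i j)) = X j := fun j => by simp [φ, hi.extend_apply]
  have hψ : ∀ j, ψ (X j) = X (i j) := fun j => by simp [ψ]
  have hψφ : ψ.comp φ = RingHom.id _ := by
    refine MvPolynomial.ringHom_ext (fun c => by simp [φ, ψ]) fun t => ?_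
    by_cases ht : ∃ j, i j = t
    · obtain ⟨j, rfl⟩ := ht
      rw [RingHom.comp_apply, hφ, hψ, RingHom.id_apply]
    · simp [φ, ψ, Function.extend_apply' _ _ _ ht]
  refine ⟨φ, hφ, le_antisymm ?_ ?_⟩
  · rw [← Ideal.map_le_iff_le_comap, Ideal.map_pow, Ideal.map_span, ← Set.range_comp]
    simp [Function.comp_def, hφ]
  · intro f hf
    have h := Ideal.mem_map_of_mem ψ (Ideal.mem_comap.mp hf)
    rw [Ideal.map_pow, Ideal.map_span, ← Set.range_comp, ← RingHom.comp_apply, hψφ] at h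
    simpa [Function.comp_def, hψ] using h

/-- The monomial `X_s ^ (m * a_s) * ∏ X_j ^ (a_j - 1)`, times the sum of the variables, shows that
no smaller number absorbs. -/
lemma lt_of_isNAbsorbing {k : Type*} [Field k] {n r : ℕ} (i : Fin r → Fin n)
    (hi : Function.Injective i) (a : Fin r → ℕ) (ha : ∀ j, 1 ≤ a j) (s : Fin r) (m N : ℕ)
    (h : IsNAbsorbing (Ideal.span
      (Set.range fun j => (X (i j) : MvPolynomial (Fin n) k) ^ a j) ^ (m + 1)) N) :
    m * a s + ∑ j, (a j - 1) < N := by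
  obtain ⟨φ, hφ, hcomap⟩ := exists_ringHom_comap_eq (k := k) i hi a (m + 1)
  by_contra! hN
  let α : Fin r →₀ ℕ := Finsupp.equivFunOnFinite.symm
    fun j => (a j - 1) + if j = s then m * a s else 0
  have hα : ∀ j, α j = (a j - 1) + if j = s then m * a s else 0 := fun _ => rfl
  have hdeg : ∑ j, α j = m * a s + ∑ j, (a j - 1) := by
    simp [hα, Finset.sum_add_distrib, add_comm]
  have hdiv : ∀ j, α j / a j = if j = s then m else 0 := by
    intro j
    have hj := ha j
    rw [hα]
    split_ifs with hjs
    · subst hjs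
      rw [Nat.add_mul_div_right _ _ hj, Nat.div_eq_of_lt (by omega), zero_add]
    · exact Nat.div_eq_of_lt (by omega)
  have hw : ∑ j, α j / a j = m := by simp [hdiv]
  have hw' : ∀ j, m + 1 ≤ ∑ l, (α + Finsupp.single j 1 : Fin r →₀ ℕ) l / a l := by
    intro j
    rw [← hw, Nat.succ_le_iff]
    refine Finset.sum_lt_sum (fun l _ => Nat.div_le_div_right (by simp)) ⟨j, Finset.mem_univ _, ?_⟩
    have hj := ha j
    rw [hdiv, Nat.lt_iff_add_one_le, Nat.le_div_iff_mul_le hj, Finsupp.add_apply,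
      Finsupp.single_eq_same, hα]
    split_ifs with hjs
    · subst hjs; rw [add_mul]; omega
    · omega
  let x : Option (Σ j, Fin (α j)) → MvPolynomial (Fin n) k :=
    fun o => o.elim (∑ j, X (i j)) fun p => X (i p.1)
  have hnone : φ (x none) = ∑ j, X j := by simp [x, hφ]
  have hsome : ∏ p, φ (x (some p)) = monomial α 1 := by
    rw [Fintype.prod_sigma, monomial_eq, Finsupp.prod_fintype _ _ (by simp)]
    simp [x, hφ]
  have hprod : ∏ o, φ (x o) = monomial α 1 * ∑ j, X j := by
    rw [Fintype.prod_option, hnone, hsome, mul_comm]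
  obtain ⟨o, -, ho⟩ := h.exists_prod_erase_mem Finset.univ x
    (by rw [Finset.card_univ, Fintype.card_option, Fintype.card_sigma]; simp [hdeg]; omega) (by
      rw [hcomap, Ideal.mem_comap, map_prod, hprod, Finset.mul_sum]
      refine Ideal.sum_mem _ fun j _ => ?_
      rw [X, monomial_mul]
      exact monomial_mem_pow a _ _ _ (hw' j))
  rw [hcomap, Ideal.mem_comap, map_prod, mem_span_X_pow_pow_iff a ha] at ho
  refine absurd (ho α ?_) (by omega)
  cases o with
  | none =>
    have he : Finset.univ.erase (none : Option (Σ j, Fin (α j))) =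
        Finset.univ.map Function.Embedding.some := by
      ext o; cases o <;> simp
    rw [he, Finset.prod_map]
    simp only [Function.Embedding.some_apply]
    rw [hsome]
    simp
  | some p =>
    have hmul : (∏ o ∈ Finset.univ.erase (some p), φ (x o)) * X p.1 =
        monomial α 1 * ∑ j, X j := by
      rw [← hprod, ← Finset.prod_erase_mul _ _ (Finset.mem_univ (some p))]
      simp [x, hφ]
    rw [← coeff_mul_X α p.1, hmul, coeff_monomial_mul, one_mul, coeff_sum]
    simp [coeff_X, Finsupp.single_left_inj (one_ne_zero : (1 : ℕ) ≠ 0)]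

lemma omegaAbs_span_X_pow_pow {k : Type*} [Field k] {n r : ℕ} (i : Fin r → Fin n)
    (hi : Function.Injective i) (a : Fin r → ℕ) (ha : ∀ j, 1 ≤ a j) (s : Fin r)
    (hs : ∀ j, a j ≤ a s) (m : ℕ) :
    omegaAbs (Ideal.span
      (Set.range fun j => (X (i j) : MvPolynomial (Fin n) k) ^ a j) ^ (m + 1)) =
      m * a s + ∑ j, (a j - 1) + 1 := by
  refine IsLeast.csInf_eq ⟨?_, fun N hN => lt_of_isNAbsorbing i hi a ha s m N hN⟩
  obtain ⟨φ, -, hcomap⟩ := exists_ringHom_comap_eq (k := k) i hi a (m + 1)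
  rw [Set.mem_ofPred_eq, hcomap]
  exact (isNAbsorbing_span_X_pow_pow a ha s hs m).comap φ

theorem omegaLinear_irreducible_monomial_iff {k : Type*} [Field k] (n r : ℕ)
    (i : Fin r → Fin n) (hi : Function.Injective i) (a : Fin r → ℕ) (ha : ∀ j, 1 ≤ a j)
    (s : Fin r) (hs : ∀ j, a j ≤ a s)
    (I : Ideal (MvPolynomial (Fin n) k))
    (hI : I = Ideal.span (Set.range fun j => (X (i j) : MvPolynomial (Fin n) k) ^ a j)) :
    (∀ m : ℕ, 1 ≤ m → omegaAbs (I ^ m) = m * omegaAbs I) ↔ ∀ j, j ≠ s → a j = 1 := by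
  have hpow : ∀ m, omegaAbs (I ^ (m + 1)) = m * a s + ∑ j, (a j - 1) + 1 := fun m =>
    hI ▸ omegaAbs_span_X_pow_pow i hi a ha s hs m
  have hone : omegaAbs I = ∑ j, (a j - 1) + 1 := by simpa using hpow 0
  have hsplit : a s - 1 + ∑ j ∈ Finset.univ.erase s, (a j - 1) = ∑ j, (a j - 1) :=
    Finset.add_sum_erase _ (fun j => a j - 1) (Finset.mem_univ s)
  have has := ha s
  constructor
  · intro h j hj
    have h2 := h 2 (by norm_num)
    rw [hpow 1, hone] at h2
    have hzero : ∑ j ∈ Finset.univ.erase s, (a j - 1) = 0 := by omega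
    have := Finset.sum_eq_zero_iff.mp hzero j (Finset.mem_erase.mpr ⟨hj, Finset.mem_univ j⟩)
    have := ha j
    omega
  · intro h m hm
    obtain ⟨m, rfl⟩ := Nat.exists_eq_add_of_le' hm
    have hzero : ∑ j ∈ Finset.univ.erase s, (a j - 1) = 0 :=
      Finset.sum_eq_zero fun j hj => by simp [h j (Finset.ne_of_mem_erase hj)]
    have hsum : ∑ j, (a j - 1) + 1 = a s := by omega
    rw [hpow, hone, add_assoc, hsum]
    ring
end
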